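/- arXiv:1708.02469 — 5 statements merged into one kernel-verified Lean document; each statement's English description precedes it below -/
import Mathlib

section
/- Upper bound for the optimal coarse cost under a Lipschitz cost (Proposition, second part): in the geometric setting where c i j = f (x i) (y j) with f L-Lipschitz in the sup product metric, c̄ k k' = f (x̄ k) (ȳ k') at representatives, and every fine point within distance A·2^{−j} of its cell representative, if π* is an optimal coupling for the fine problem and π̄* an optimal coarse coupling for the coarse problem, then C̄(π̄*) ≤ C(π*) + 2^{−j} · A · L. -/
open Finset

/-- Upper bound for the optimal coarse cost under a Lipschitz cost:
`C̄(π̄*) ≤ C(π*) + 2^{-j} * A * L`. -/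
theorem stmt_4 (n m K K' : ℕ) (hn : 1 ≤ n) (hm : 1 ≤ m) (hK : 1 ≤ K) (hK' : 1 ≤ K')
    (w : Fin n → ℝ) (v : Fin m → ℝ)
    (hw : ∀ i, 0 < w i) (hv : ∀ j, 0 < v j)
    (hw1 : ∑ i, w i = 1) (hv1 : ∑ j, v j = 1)
    (M : Type*) [MetricSpace M]
    (x : Fin n → M) (y : Fin m → M)
    (L A : ℝ) (hL : 0 < L) (hA : 0 < A) (j : ℕ)
    (f : M → M → ℝ)
    (hf : ∀ p p' q q', |f p q - f p' q'| ≤ L * max (dist p p') (dist q q'))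
    (a : Fin n → Fin K) (b : Fin m → Fin K')
    (xb : Fin K → M) (yb : Fin K' → M)
    (hx : ∀ i, dist (xb (a i)) (x i) ≤ A * (2:ℝ) ^ (-(j:ℝ)))
    (hy : ∀ j', dist (yb (b j')) (y j') ≤ A * (2:ℝ) ^ (-(j:ℝ)))
    -- `πs` is an optimal fine coupling for the cost `c i j' = f (x i) (y j')`
    (πs : Fin n → Fin m → ℝ)
    (hπs0 : ∀ i j', 0 ≤ πs i j')
    (hπsrow : ∀ i, ∑ j', πs i j' = w i)
    (hπscol : ∀ j', ∑ i, πs i j' = v j')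
    (hπsopt : ∀ π : Fin n → Fin m → ℝ,
      (∀ i j', 0 ≤ π i j') → (∀ i, ∑ j', π i j' = w i) → (∀ j', ∑ i, π i j' = v j') →
      ∑ i, ∑ j', f (x i) (y j') * πs i j' ≤ ∑ i, ∑ j', f (x i) (y j') * π i j')
    -- `πb` is an optimal coarse coupling for the cost `c̄ k k' = f (x̄ k) (ȳ k')`
    (πb : Fin K → Fin K' → ℝ)
    (hπb0 : ∀ k k', 0 ≤ πb k k')
    (hπbrow : ∀ k, ∑ k', πb k k' = ∑ i ∈ univ.filter (fun i => a i = k), w i)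
    (hπbcol : ∀ k', ∑ k, πb k k' = ∑ j' ∈ univ.filter (fun j' => b j' = k'), v j')
    (hπbopt : ∀ σ : Fin K → Fin K' → ℝ,
      (∀ k k', 0 ≤ σ k k') →
      (∀ k, ∑ k', σ k k' = ∑ i ∈ univ.filter (fun i => a i = k), w i) →
      (∀ k', ∑ k, σ k k' = ∑ j' ∈ univ.filter (fun j' => b j' = k'), v j') →
      ∑ k, ∑ k', f (xb k) (yb k') * πb k k'
        ≤ ∑ k, ∑ k', f (xb k) (yb k') * σ k k') :
    ∑ k, ∑ k', f (xb k) (yb k') * πb k k'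
      ≤ (∑ i, ∑ j', f (x i) (y j') * πs i j') + (2:ℝ) ^ (-(j:ℝ)) * A * L := by
  have h1 := hπbopt (fun k k' => ∑ i ∈ univ.filter (fun i => a i = k),
      ∑ j' ∈ univ.filter (fun j' => b j' = k'), πs i j')
    (fun k k' => Finset.sum_nonneg fun i _ => Finset.sum_nonneg fun j' _ => hπs0 i j')
    (by
      intro k
      rw [Finset.sum_comm]
      refine Finset.sum_congr rfl fun i _ => ?_
      rw [Finset.sum_fiberwise, hπsrow])
    (by
      intro k'
      rw [Finset.sum_fiberwise univ a
        (fun i => ∑ j' ∈ univ.filter (fun j' => b j' = k'), πs i j'), Finset.sum_comm]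
      exact Finset.sum_congr rfl fun j' _ => hπscol j')
  refine h1.trans ?_
  have h2 : ∑ k, ∑ k', f (xb k) (yb k') * (∑ i ∈ univ.filter (fun i => a i = k),
      ∑ j' ∈ univ.filter (fun j' => b j' = k'), πs i j')
      = ∑ i, ∑ j', f (xb (a i)) (yb (b j')) * πs i j' := by
    rw [← Finset.sum_fiberwise univ a]
    refine Finset.sum_congr rfl fun k _ => ?_
    simp_rw [Finset.mul_sum]
    rw [Finset.sum_comm]
    refine Finset.sum_congr rfl fun i hi => ?_
    rw [← Finset.sum_fiberwise univ b (fun j' => f (xb (a i)) (yb (b j')) * πs i j')]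
    refine Finset.sum_congr rfl fun k' _ => ?_
    refine Finset.sum_congr rfl fun j' hj => ?_
    rw [(Finset.mem_filter.1 hi).2, (Finset.mem_filter.1 hj).2]
  rw [h2]
  have h3 : (2:ℝ) ^ (-(j:ℝ)) * A * L
      = ∑ i, ∑ j', ((2:ℝ) ^ (-(j:ℝ)) * A * L) * πs i j' := by
    simp_rw [← Finset.mul_sum, hπsrow, hw1, mul_one]
  rw [h3, ← Finset.sum_add_distrib]
  refine Finset.sum_le_sum fun i _ => ?_
  rw [← Finset.sum_add_distrib]
  refine Finset.sum_le_sum fun j' _ => ?_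
  rw [← add_mul]
  refine mul_le_mul_of_nonneg_right ?_ (hπs0 i j')
  have h4 := (le_abs_self _).trans (hf (xb (a i)) (x i) (yb (b j')) (y j'))
  have h5 := mul_le_mul_of_nonneg_left (max_le (hx i) (hy j')) hL.le
  linarith
end

section
/- Strong duality for the discrete transport linear program: there exist potentials φ : Fin n → ℝ and ψ : Fin m → ℝ with φ i − ψ j ≤ c i j for all i, j, and a coupling π* of (w, v), such that ∑ i, w i * φ i − ∑ j, v j * ψ j = C(π*) and C(π*) ≤ C(π) for every coupling π. -/
open Finset

lemma aux_double {n m : ℕ} (w : Fin n → ℝ) (v : Fin m → ℝ)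
    (hw1 : ∑ i, w i = 1) (hv1 : ∑ j, v j = 1) (a : Fin n → ℝ) (b : Fin m → ℝ) :
    ∑ i, ∑ j, w i * v j * (a i - b j) = ∑ i, w i * a i - ∑ j, v j * b j := by
  have h1 : ∀ i, ∑ j, w i * v j * (a i - b j) = w i * a i - w i * ∑ j, v j * b j := by
    intro i
    have : ∀ j, w i * v j * (a i - b j) = (w i * a i) * v j - w i * (v j * b j) := by
      intro j; ring
    simp_rw [this]
    rw [Finset.sum_sub_distrib, ← Finset.mul_sum, ← Finset.mul_sum, hv1, mul_one]
  simp_rw [h1]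
  rw [Finset.sum_sub_distrib, ← Finset.sum_mul, hw1, one_mul]

lemma aux_dual {n m : ℕ} (hn : 1 ≤ n) (hm : 1 ≤ m)
    (w : Fin n → ℝ) (v : Fin m → ℝ) (c : Fin n → Fin m → ℝ)
    (hw : ∀ i, 0 < w i) (hv : ∀ j, 0 < v j)
    (hw1 : ∑ i, w i = 1) (hv1 : ∑ j, v j = 1) :
    ∃ (φ : Fin n → ℝ) (ψ : Fin m → ℝ), (∀ i j, φ i - ψ j ≤ c i j) ∧
      ∀ (φ' : Fin n → ℝ) (ψ' : Fin m → ℝ), (∀ i j, φ' i - ψ' j ≤ c i j) →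
        (∑ i, w i * φ' i) - (∑ j, v j * ψ' j) ≤ (∑ i, w i * φ i) - (∑ j, v j * ψ j) := by
  obtain ⟨K, hK⟩ : ∃ K, ∀ i j, |c i j| ≤ K := by
    refine ⟨∑ i, ∑ j, |c i j|, fun i j => ?_⟩
    refine le_trans ?_ (Finset.single_le_sum (f := fun i => ∑ j, |c i j|)
      (fun i _ => Finset.sum_nonneg fun j _ => abs_nonneg _) (Finset.mem_univ i))
    exact Finset.single_le_sum (f := fun j => |c i j|) (fun j _ => abs_nonneg _) (Finset.mem_univ j)
  let i0 : Fin n := ⟨0, hn⟩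
  let j0 : Fin m := ⟨0, hm⟩
  have hK0 : 0 ≤ K := (abs_nonneg _).trans (hK i0 j0)
  let B : ℝ := ∑ i, ∑ j, 2 * K / (w i * v j)
  have hpos : ∀ i j, 0 ≤ 2 * K / (w i * v j) := fun i j =>
    div_nonneg (by linarith) (mul_pos (hw i) (hv j)).le
  have hB : ∀ i j, 2 * K / (w i * v j) ≤ B := by
    intro i j
    refine le_trans ?_ (Finset.single_le_sum (f := fun i => ∑ j, 2 * K / (w i * v j))
      (fun i _ => Finset.sum_nonneg fun j _ => hpos i j) (Finset.mem_univ i))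
    exact Finset.single_le_sum (f := fun j => 2 * K / (w i * v j)) (fun j _ => hpos i j)
      (Finset.mem_univ j)
  have hB0 : 0 ≤ B := (hpos i0 j0).trans (hB i0 j0)
  let F : (Fin n → ℝ) × (Fin m → ℝ) → ℝ := fun p => (∑ i, w i * p.1 i) - (∑ j, v j * p.2 j)
  have hF : Continuous F := by fun_prop
  let S : Set ((Fin n → ℝ) × (Fin m → ℝ)) :=
    {p | (∀ i j, p.1 i - p.2 j ≤ c i j) ∧ p.2 j0 = 0 ∧ -K ≤ F p}
  have hSc : IsClosed S := by
    have hSe : S = (⋂ i, ⋂ j, {p | p.1 i - p.2 j ≤ c i j}) ∩ ({p | p.2 j0 = 0} ∩ {p | -K ≤ F p}) := by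
      ext p; simp [S]
    rw [hSe]
    refine IsClosed.inter ?_ (IsClosed.inter ?_ ?_)
    · refine isClosed_iInter fun i => isClosed_iInter fun j => ?_
      exact isClosed_le (by fun_prop) (by fun_prop)
    · exact isClosed_eq (by fun_prop) (by fun_prop)
    · exact isClosed_le (by fun_prop) hF
  have hlow : ∀ p ∈ S, ∀ i j, K - (p.1 i - p.2 j) ≤ B := by
    rintro p ⟨h1, h2, h3⟩ i j
    have hnn : ∀ i j, 0 ≤ w i * v j * (K - (p.1 i - p.2 j)) := fun i j =>
      mul_nonneg (mul_pos (hw i) (hv j)).le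
        (by have := h1 i j; have := le_abs_self (c i j); have := hK i j; linarith)
    have hs : ∑ i, ∑ j, w i * v j * (K - (p.1 i - p.2 j)) = K - F p := by
      have := aux_double w v hw1 hv1 (fun i => K - p.1 i) (fun j => - p.2 j)
      have e : ∀ i j, w i * v j * (K - (p.1 i - p.2 j)) = w i * v j * (K - p.1 i - -p.2 j) := by
        intro i j; ring
      simp_rw [e, this, mul_sub, mul_neg, Finset.sum_sub_distrib, Finset.sum_neg_distrib,
        ← Finset.sum_mul, hw1, F]
      ring
    have hle : w i * v j * (K - (p.1 i - p.2 j)) ≤ 2 * K := by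
      have : w i * v j * (K - (p.1 i - p.2 j)) ≤ ∑ i, ∑ j, w i * v j * (K - (p.1 i - p.2 j)) := by
        refine le_trans ?_ (Finset.single_le_sum
          (f := fun i => ∑ j, w i * v j * (K - (p.1 i - p.2 j)))
          (fun i _ => Finset.sum_nonneg fun j _ => hnn i j) (Finset.mem_univ i))
        exact Finset.single_le_sum (f := fun j => w i * v j * (K - (p.1 i - p.2 j)))
          (fun j _ => hnn i j) (Finset.mem_univ j)
      linarith
    refine le_trans ?_ (hB i j)
    rw [le_div_iff₀ (mul_pos (hw i) (hv j))]
    linarith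
  have hSsub : S ⊆ (Set.Icc (fun _ => -B) (fun _ => K)) ×ˢ
      (Set.Icc (fun _ => -(B + K)) (fun _ => B + K)) := by
    intro p hp
    have hl := hlow p hp
    obtain ⟨h1, h2, h3⟩ := hp
    have hu : ∀ i j, p.1 i - p.2 j ≤ K := fun i j =>
      (h1 i j).trans ((le_abs_self _).trans (hK i j))
    refine ⟨⟨fun i => ?_, fun i => ?_⟩, ⟨fun j => ?_, fun j => ?_⟩⟩
    · have := hl i j0; simp only; linarith
    · have := hu i j0; simp only; linarith
    · have := hu i0 j; have := hl i0 j0; simp only; linarith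
    · have := hl i0 j; have := hu i0 j0; simp only; linarith
  have hScomp : IsCompact S := (isCompact_Icc.prod isCompact_Icc).of_isClosed_subset hSc hSsub
  have hne : S.Nonempty := by
    refine ⟨(fun _ => -K, fun _ => 0), fun i j => ?_, rfl, ?_⟩
    · have := neg_abs_le (c i j); have := hK i j; simp only; linarith
    · simp only [F, ← Finset.sum_mul, hw1]; simp
  obtain ⟨p, hp, hmax⟩ := hScomp.exists_isMaxOn hne hF.continuousOn
  refine ⟨p.1, p.2, hp.1, fun φ' ψ' hf => ?_⟩
  have hpK : -K ≤ F p := hp.2.2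
  change F (φ', ψ') ≤ F p
  by_cases hc : -K ≤ F (φ', ψ')
  · have e : F (fun i => φ' i - ψ' j0, fun j => ψ' j - ψ' j0) = F (φ', ψ') := by
      simp only [F, mul_sub, Finset.sum_sub_distrib, ← Finset.sum_mul, hw1, hv1]; ring
    rw [← e] at hc ⊢
    exact hmax (show _ ∈ S from ⟨fun i j => by have := hf i j; simp only; linarith, by simp, hc⟩)
  · linarith

/-- Strong duality for the discrete transport linear program. -/
theorem stmt_7 (n m : ℕ) (hn : 1 ≤ n) (hm : 1 ≤ m)
    (w : Fin n → ℝ) (v : Fin m → ℝ) (c : Fin n → Fin m → ℝ)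
    (hw : ∀ i, 0 < w i) (hv : ∀ j, 0 < v j)
    (hw1 : ∑ i, w i = 1) (hv1 : ∑ j, v j = 1) :
    ∃ (φ : Fin n → ℝ) (ψ : Fin m → ℝ) (πs : Fin n → Fin m → ℝ),
      (∀ i j, φ i - ψ j ≤ c i j) ∧
      ((∀ i j, 0 ≤ πs i j) ∧ (∀ i, ∑ j, πs i j = w i) ∧ (∀ j, ∑ i, πs i j = v j)) ∧
      (∑ i, w i * φ i) - (∑ j, v j * ψ j) = ∑ i, ∑ j, c i j * πs i j ∧
      ∀ π : Fin n → Fin m → ℝ,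
        (∀ i j, 0 ≤ π i j) → (∀ i, ∑ j, π i j = w i) → (∀ j, ∑ i, π i j = v j) →
        ∑ i, ∑ j, c i j * πs i j ≤ ∑ i, ∑ j, c i j * π i j := by
  obtain ⟨φ, ψ, hf, hmax⟩ := aux_dual hn hm w v c hw hv hw1 hv1
  set D := (∑ i, w i * φ i) - (∑ j, v j * ψ j) with hD
  let T : (Fin n × Fin m → ℝ) →ₗ[ℝ] (Fin n → ℝ) × (Fin m → ℝ) × ℝ :=
    { toFun := fun p => (fun i => ∑ j, p (i, j), fun j => ∑ i, p (i, j),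
        ∑ i, ∑ j, c i j * p (i, j))
      map_add' := by
        intro p q
        ext <;> simp [Finset.sum_add_distrib, mul_add]
      map_smul' := by
        intro r p
        ext <;> simp [Finset.mul_sum, mul_left_comm] }
  have hTc : Continuous T := T.continuous_of_finiteDimensional
  let A := T '' stdSimplex ℝ (Fin n × Fin m)
  have hmem : (w, v, D) ∈ A := by
    by_contra hnot
    have hAc : IsCompact A := (isCompact_stdSimplex ℝ (Fin n × Fin m)).image hTc
    have hAconv : Convex ℝ A := (convex_stdSimplex ℝ (Fin n × Fin m)).linear_image T
    obtain ⟨f, u, h1, h2⟩ := geometric_hahn_banach_point_closed hAconv hAc.isClosed hnot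
    obtain ⟨a, b, γ, hfe⟩ : ∃ (a : Fin n → ℝ) (b : Fin m → ℝ) (γ : ℝ), ∀ x y s,
        f (x, y, s) = ∑ i, x i * a i + ∑ j, y j * b j + s * γ := by
      refine ⟨fun i => f (Pi.single i 1, 0, 0), fun j => f (0, Pi.single j 1, 0), f (0, 0, 1), ?_⟩
      intro x y s
      have e : ((x, y, s) : (Fin n → ℝ) × (Fin m → ℝ) × ℝ) =
          ∑ i, x i • ((Pi.single i 1, 0, 0) : (Fin n → ℝ) × (Fin m → ℝ) × ℝ) +
          ∑ j, y j • ((0, Pi.single j 1, 0) : (Fin n → ℝ) × (Fin m → ℝ) × ℝ) +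
          s • ((0, 0, 1) : (Fin n → ℝ) × (Fin m → ℝ) × ℝ) := by
        ext k <;> simp [Prod.fst_sum, Prod.snd_sum, Finset.sum_apply, Pi.single_apply]
      rw [e]
      simp only [map_add, map_sum, map_smul, smul_eq_mul]
    have hij : ∀ i j, u < a i + b j + c i j * γ := by
      intro i j
      have := h2 (T (Pi.single (i, j) 1)) ⟨_, single_mem_stdSimplex ℝ (i, j), rfl⟩
      have e : T (Pi.single (i, j) 1) = (Pi.single i 1, Pi.single j 1, c i j) := by
        ext k
        · simp only [T, LinearMap.coe_mk, AddHom.coe_mk, Pi.single_apply, Prod.mk.injEq]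
          by_cases h : k = i <;> simp [h]
        · simp only [T, LinearMap.coe_mk, AddHom.coe_mk, Pi.single_apply, Prod.mk.injEq]
          by_cases h : k = j <;> simp [h]
        · simp only [T, LinearMap.coe_mk, AddHom.coe_mk, Pi.single_apply, Prod.mk.injEq]
          simp [ite_and]
      rw [e, hfe] at this
      simpa [Pi.single_apply] using this
    rw [hfe] at h1
    rcases lt_trichotomy γ 0 with hγ | hγ | hγ
    · have key : ∀ i j, u < a i + γ * φ i - (γ * ψ j - b j) := by
        intro i j
        have := hij i j
        have := mul_le_mul_of_nonpos_right (hf i j) hγ.le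
        nlinarith
      have hs := aux_double w v hw1 hv1 (fun i => a i + γ * φ i) (fun j => γ * ψ j - b j)
      have hs2 := aux_double w v hw1 hv1 (fun i => u) (fun j => 0)
      have : ∑ i, ∑ j, w i * v j * (u - 0) ≤
          ∑ i, ∑ j, w i * v j * (a i + γ * φ i - (γ * ψ j - b j)) := by
        refine Finset.sum_le_sum fun i _ => Finset.sum_le_sum fun j _ => ?_
        refine mul_le_mul_of_nonneg_left ?_ (mul_pos (hw i) (hv j)).le
        have := key i j
        linarith
      rw [hs, hs2] at this
      simp only [mul_add, mul_sub, mul_left_comm _ γ, Finset.sum_add_distrib,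
        Finset.sum_sub_distrib, ← Finset.mul_sum, ← Finset.sum_mul, hw1, mul_zero,
        Finset.sum_const_zero] at this
      nlinarith
    · subst hγ
      have := hmax (fun i => φ i - (a i - u)) (fun j => ψ j + b j) (fun i j => by
        have := hij i j; have := hf i j; linarith)
      simp only [mul_add, mul_sub, Finset.sum_add_distrib,
        Finset.sum_sub_distrib, ← Finset.sum_mul, hw1] at this
      linarith
    · have := hmax (fun i => (u - a i) / γ) (fun j => b j / γ) (fun i j => by
        have := hij i j
        rw [← sub_div, div_le_iff₀ hγ]; linarith)
      simp only [← mul_div_assoc, ← Finset.sum_div, mul_sub,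
        Finset.sum_sub_distrib, ← Finset.sum_mul, hw1] at this
      rw [← sub_div, div_le_iff₀ hγ] at this
      linarith
  obtain ⟨p, ⟨hp0, hp1⟩, hpT⟩ := hmem
  have e1 : (fun i => ∑ j, p (i, j)) = w := congrArg Prod.fst hpT
  have e2 : (fun j => ∑ i, p (i, j)) = v := congrArg (fun q => q.2.1) hpT
  have e3 : ∑ i, ∑ j, c i j * p (i, j) = D := congrArg (fun q => q.2.2) hpT
  refine ⟨φ, ψ, fun i j => p (i, j), hf, ⟨fun i j => hp0 _, congrFun e1, congrFun e2⟩, e3.symm, ?_⟩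
  intro π h0 hr hc
  rw [e3]
  have hle : ∑ i, ∑ j, (φ i - ψ j) * π i j ≤ ∑ i, ∑ j, c i j * π i j :=
    Finset.sum_le_sum fun i _ => Finset.sum_le_sum fun j _ =>
      mul_le_mul_of_nonneg_right (hf i j) (h0 i j)
  have he : ∑ i, ∑ j, (φ i - ψ j) * π i j = D := by
    simp only [sub_mul, Finset.sum_sub_distrib]
    rw [Finset.sum_comm (f := fun i j => ψ j * π i j)]
    simp only [← Finset.mul_sum, hr, hc, hD]
    simp only [mul_comm]
  linarith
end

section
/- Sufficiency of nonnegative reduced costs with complementary slackness: if π is a coupling of (w, v) and φ : Fin n → ℝ, ψ : Fin m → ℝ satisfy the reduced-cost inequality c i j − φ i + ψ j ≥ 0 for all i, j, and π i j > 0 implies c i j − φ i + ψ j = 0, then π is optimal: C(π) ≤ C(π') for every coupling π'. -/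
open Finset

/-- Sufficiency of nonnegative reduced costs with complementary slackness. -/
theorem stmt_8 (n m : ℕ) (hn : 1 ≤ n) (hm : 1 ≤ m)
    (w : Fin n → ℝ) (v : Fin m → ℝ) (c : Fin n → Fin m → ℝ)
    (hw : ∀ i, 0 < w i) (hv : ∀ j, 0 < v j)
    (hw1 : ∑ i, w i = 1) (hv1 : ∑ j, v j = 1)
    (π : Fin n → Fin m → ℝ)
    (hπ0 : ∀ i j, 0 ≤ π i j)
    (hπrow : ∀ i, ∑ j, π i j = w i)
    (hπcol : ∀ j, ∑ i, π i j = v j)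
    (φ : Fin n → ℝ) (ψ : Fin m → ℝ)
    (hred : ∀ i j, 0 ≤ c i j - φ i + ψ j)
    (hslack : ∀ i j, 0 < π i j → c i j - φ i + ψ j = 0) :
    ∀ π' : Fin n → Fin m → ℝ,
      (∀ i j, 0 ≤ π' i j) → (∀ i, ∑ j, π' i j = w i) → (∀ j, ∑ i, π' i j = v j) →
      ∑ i, ∑ j, c i j * π i j ≤ ∑ i, ∑ j, c i j * π' i j := by
  intro π' h0 hr hc
  have key : ∀ p : Fin n → Fin m → ℝ, (∀ i, ∑ j, p i j = w i) → (∀ j, ∑ i, p i j = v j) →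
      ∑ i, ∑ j, c i j * p i j = ∑ i, ∑ j, (c i j - φ i + ψ j) * p i j
        + (∑ i, φ i * w i - ∑ j, ψ j * v j) := by
    intro p h1 h2
    have e1 : ∑ i, φ i * w i = ∑ i, ∑ j, φ i * p i j := by
      simp only [← Finset.mul_sum, h1]
    have e2 : ∑ j, ψ j * v j = ∑ i, ∑ j, ψ j * p i j := by
      rw [Finset.sum_comm]
      simp only [← Finset.mul_sum, h2]
    rw [e1, e2]
    simp only [← Finset.sum_sub_distrib, ← Finset.sum_add_distrib]
    refine Finset.sum_congr rfl fun i _ => Finset.sum_congr rfl fun j _ => ?_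
    ring
  rw [key π hπrow hπcol, key π' hr hc]
  refine add_le_add (Finset.sum_le_sum fun i _ => Finset.sum_le_sum fun j _ => ?_) le_rfl
  have hz : (c i j - φ i + ψ j) * π i j = 0 := by
    rcases (hπ0 i j).eq_or_lt with h | h
    · rw [← h, mul_zero]
    · rw [hslack i j h, zero_mul]
  rw [hz]
  exact mul_nonneg (hred i j) (h0 i j)
end

section
/- Existence of a sparse optimal coupling: there exists an optimal coupling π* of (w, v) (i.e. C(π*) ≤ C(π) for every coupling π) whose support {(i,j) : π* i j ≠ 0} has cardinality at most n + m − 1. -/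
open Finset

def IsCoup12 {n m : ℕ} (w : Fin n → ℝ) (v : Fin m → ℝ) (π : Fin n → Fin m → ℝ) : Prop :=
  (∀ i j, 0 ≤ π i j) ∧ (∀ i, ∑ j, π i j = w i) ∧ (∀ j, ∑ i, π i j = v j)

lemma exists_opt12 {n m : ℕ} (w : Fin n → ℝ) (v : Fin m → ℝ) (c : Fin n → Fin m → ℝ)
    (hw : ∀ i, 0 < w i) (hv : ∀ j, 0 < v j)
    (hw1 : ∑ i, w i = 1) (hv1 : ∑ j, v j = 1) :
    ∃ π, IsCoup12 w v π ∧ ∀ ρ, IsCoup12 w v ρ →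
      ∑ i, ∑ j, c i j * π i j ≤ ∑ i, ∑ j, c i j * ρ i j := by
  have hcl : IsClosed {π : Fin n → Fin m → ℝ | IsCoup12 w v π} := by
    have e : {π : Fin n → Fin m → ℝ | IsCoup12 w v π} =
      (⋂ i, ⋂ j, {π : Fin n → Fin m → ℝ | 0 ≤ π i j}) ∩
      ((⋂ i, {π : Fin n → Fin m → ℝ | ∑ j, π i j = w i}) ∩
      (⋂ j, {π : Fin n → Fin m → ℝ | ∑ i, π i j = v j})) := by
      ext π; simp [IsCoup12]
    rw [e]
    refine IsClosed.inter ?_ (IsClosed.inter ?_ ?_)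
    · exact isClosed_iInter fun i => isClosed_iInter fun j =>
        isClosed_le (by fun_prop) (by fun_prop)
    · exact isClosed_iInter fun i => isClosed_eq (by fun_prop) (by fun_prop)
    · exact isClosed_iInter fun i => isClosed_eq (by fun_prop) (by fun_prop)
  have hsub : {π : Fin n → Fin m → ℝ | IsCoup12 w v π} ⊆ Set.Icc 0 (fun i _ => w i) := by
    intro π hπ
    refine ⟨fun i j => hπ.1 i j, fun i j => ?_⟩
    show π i j ≤ w i
    rw [← hπ.2.1 i]
    exact Finset.single_le_sum (f := fun j => π i j) (fun j _ => hπ.1 i j) (Finset.mem_univ j)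
  have hc : IsCompact {π : Fin n → Fin m → ℝ | IsCoup12 w v π} :=
    isCompact_Icc.of_isClosed_subset hcl hsub
  have hne : {π : Fin n → Fin m → ℝ | IsCoup12 w v π}.Nonempty := by
    refine ⟨fun i j => w i * v j, fun i j => (mul_pos (hw i) (hv j)).le, fun i => ?_, fun j => ?_⟩
    · rw [← Finset.mul_sum, hv1, mul_one]
    · rw [← Finset.sum_mul, hw1, one_mul]
  obtain ⟨π, h1, h2⟩ := hc.exists_isMinOn hne
    (f := fun π : Fin n → Fin m → ℝ => ∑ i, ∑ j, c i j * π i j)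
    (Continuous.continuousOn (by fun_prop))
  exact ⟨π, h1, fun ρ hρ => h2 hρ⟩

lemma exists_dir12 {n k : ℕ} (S : Finset (Fin n × Fin (k+1))) (hS : n + k < S.card) :
    ∃ d : Fin n → Fin (k+1) → ℝ, d ≠ 0 ∧ (∀ i, ∑ j, d i j = 0) ∧ (∀ j, ∑ i, d i j = 0) ∧
      ∀ p, p ∉ S → d p.1 p.2 = 0 := by
  let L : (Fin n → Fin (k+1) → ℝ) →ₗ[ℝ]
      ((Fin n → ℝ) × (Fin k → ℝ) × ({p // p ∈ Sᶜ} → ℝ)) :=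
    { toFun := fun d => (fun i => ∑ j, d i j, fun j => ∑ i, d i j.castSucc, fun p => d p.1.1 p.1.2)
      map_add' := by
        intro x y; ext <;> simp [Finset.sum_add_distrib]
      map_smul' := by
        intro x y; ext <;> simp [Finset.mul_sum] }
  have hcard : Sᶜ.card + S.card = n * (k+1) := by
    rw [Finset.card_compl_add_card]; simp
  have hk := LinearMap.ker_ne_bot_of_finrank_lt (f := L) (by
    simp only [Module.finrank_prod, Module.finrank_pi_fintype, Module.finrank_self,
      Finset.sum_const, Finset.card_univ, Fintype.card_fin, Fintype.card_coe, smul_eq_mul, mul_one]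
    omega)
  obtain ⟨d, hd, hd0⟩ := Submodule.exists_mem_ne_zero_of_ne_bot hk
  have hL : L d = 0 := hd
  have h1 : ∀ i, ∑ j, d i j = 0 := fun i => congrFun (congrArg Prod.fst hL) i
  have h2 : ∀ j : Fin k, ∑ i, d i j.castSucc = 0 := fun j =>
    congrFun (congrArg (fun x => x.2.1) hL) j
  have h3 : ∀ p, p ∉ S → d p.1 p.2 = 0 := fun p hp =>
    congrFun (congrArg (fun x => x.2.2) hL) ⟨p, by simpa using hp⟩
  refine ⟨d, hd0, h1, fun j => ?_, h3⟩
  refine Fin.lastCases ?_ h2 j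
  have := Finset.sum_comm (s := Finset.univ) (t := Finset.univ) (f := fun i j => d i j)
  rw [Fin.sum_univ_castSucc (n := k)] at this
  simpa [h1, h2] using this.symm

theorem stmt_12 (n m : ℕ) (hn : 1 ≤ n) (hm : 1 ≤ m)
    (w : Fin n → ℝ) (v : Fin m → ℝ) (c : Fin n → Fin m → ℝ)
    (hw : ∀ i, 0 < w i) (hv : ∀ j, 0 < v j)
    (hw1 : ∑ i, w i = 1) (hv1 : ∑ j, v j = 1) :
    ∃ πs : Fin n → Fin m → ℝ,
      ((∀ i j, 0 ≤ πs i j) ∧ (∀ i, ∑ j, πs i j = w i) ∧ (∀ j, ∑ i, πs i j = v j)) ∧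
      (∀ π : Fin n → Fin m → ℝ,
        (∀ i j, 0 ≤ π i j) → (∀ i, ∑ j, π i j = w i) → (∀ j, ∑ i, π i j = v j) →
        ∑ i, ∑ j, c i j * πs i j ≤ ∑ i, ∑ j, c i j * π i j) ∧
      {p : Fin n × Fin m | πs p.1 p.2 ≠ 0}.ncard ≤ n + m - 1 := by
  classical
  obtain ⟨k, rfl⟩ : ∃ k, m = k + 1 := ⟨m - 1, by omega⟩
  let Opt : (Fin n → Fin (k+1) → ℝ) → Prop := fun π => IsCoup12 w v π ∧ ∀ ρ, IsCoup12 w v ρ →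
      ∑ i, ∑ j, c i j * π i j ≤ ∑ i, ∑ j, c i j * ρ i j
  let N : (Fin n → Fin (k+1) → ℝ) → ℕ := fun π => {p : Fin n × Fin (k+1) | π p.1 p.2 ≠ 0}.ncard
  have hex : ∃ N0, ∃ π, Opt π ∧ N π = N0 := by
    obtain ⟨π, h⟩ := exists_opt12 w v c hw hv hw1 hv1
    exact ⟨_, π, h, rfl⟩
  obtain ⟨π, hπ, hN⟩ := Nat.find_spec hex
  have hmin : ∀ ρ, Opt ρ → N π ≤ N ρ := fun ρ hρ => hN ▸ Nat.find_min' hex ⟨ρ, hρ, rfl⟩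
  refine ⟨π, hπ.1, fun ρ a b c => hπ.2 ρ ⟨a, b, c⟩, ?_⟩
  by_contra hlt
  let S : Finset (Fin n × Fin (k+1)) := univ.filter fun p => π p.1 p.2 ≠ 0
  have hS : {p : Fin n × Fin (k+1) | π p.1 p.2 ≠ 0} = (S : Set _) := by ext; simp [S]
  rw [hS, Set.ncard_coe_finset] at hlt
  obtain ⟨d, hd0, hr, hc, hs⟩ : ∃ d : Fin n → Fin (k+1) → ℝ, d ≠ 0 ∧ (∀ i, ∑ j, d i j = 0) ∧
      (∀ j, ∑ i, d i j = 0) ∧ (∀ p, p ∉ S → d p.1 p.2 = 0) ∧ 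
      True := by
    obtain ⟨d, a, b, c, e⟩ := exists_dir12 S (by omega)
    exact ⟨d, a, b, c, e, trivial⟩
  obtain ⟨d, hd0, hr, hc, hs, hcost⟩ : ∃ d : Fin n → Fin (k+1) → ℝ, d ≠ 0 ∧
      (∀ i, ∑ j, d i j = 0) ∧
      (∀ j, ∑ i, d i j = 0) ∧ (∀ p, p ∉ S → d p.1 p.2 = 0) ∧
      ∑ i, ∑ j, c i j * d i j ≤ 0 := by
    rcases le_total (∑ i, ∑ j, c i j * d i j) 0 with h | h
    · exact ⟨d, hd0, hr, hc, hs.1, h⟩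
    · exact ⟨-d, by simpa using hd0, by simpa using hr, by simpa using hc,
        by simpa using hs.1, by simpa using h⟩
  let T : Finset (Fin n × Fin (k+1)) := univ.filter fun p => d p.1 p.2 < 0
  have hT : T.Nonempty := by
    by_contra hT
    have hpos : ∀ i j, 0 ≤ d i j := by
      intro i j
      by_contra h
      exact hT ⟨(i, j), by simpa [T] using h⟩
    apply hd0
    ext i j
    exact (Finset.sum_eq_zero_iff_of_nonneg (fun j _ => hpos i j)).1 (hr i) j (mem_univ j)
  obtain ⟨q, hqT, hq⟩ := T.exists_min_image (fun p => π p.1 p.2 / (- d p.1 p.2)) hT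
  have hqd : d q.1 q.2 < 0 := by simpa [T] using hqT
  set t : ℝ := π q.1 q.2 / (- d q.1 q.2) with ht
  have ht0 : 0 ≤ t := div_nonneg (hπ.1.1 _ _) (by linarith)
  have htq : π q.1 q.2 + t * d q.1 q.2 = 0 := by
    rw [ht]; field_simp [hqd.ne]; ring
  let ρ : Fin n → Fin (k+1) → ℝ := fun i j => π i j + t * d i j
  have hρ : IsCoup12 w v ρ := by
    refine ⟨fun i j => ?_, fun i => ?_, fun j => ?_⟩
    · show 0 ≤ π i j + t * d i j
      rcases le_or_gt 0 (d i j) with h | h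
      · exact add_nonneg (hπ.1.1 i j) (mul_nonneg ht0 h)
      · have := hq (i, j) (by simpa [T] using h)
        rw [le_div_iff₀ (by simpa using h)] at this
        simp only at this
        linarith
    · simp only [ρ, Finset.sum_add_distrib, ← Finset.mul_sum, hr, hπ.1.2.1]; ring
    · simp only [ρ, Finset.sum_add_distrib, ← Finset.mul_sum, hc, hπ.1.2.2]; ring
  have hρc : ∑ i, ∑ j, c i j * ρ i j ≤ ∑ i, ∑ j, c i j * π i j := by
    have : ∑ i, ∑ j, c i j * ρ i j =
        ∑ i, ∑ j, c i j * π i j + t * ∑ i, ∑ j, c i j * d i j := by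
      simp only [Finset.mul_sum, ← Finset.sum_add_distrib, ρ]
      refine Finset.sum_congr rfl fun i _ => Finset.sum_congr rfl fun j _ => by ring
    rw [this]
    linarith [mul_nonpos_of_nonneg_of_nonpos ht0 hcost]
  have h1 := hmin ρ ⟨hρ, fun σ hσ => hρc.trans (hπ.2 σ hσ)⟩
  have h2 : N ρ < N π := by
    apply Set.ncard_lt_ncard _ (Set.toFinite _)
    rw [Set.ssubset_iff_of_subset]
    · refine ⟨q, ?_, ?_⟩
      · intro h
        have := hs q (by simpa [S] using h)
        linarith
      · simpa [ρ] using htq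
    · intro p hp h
      apply hp
      have := hs p (by simpa [S] using h)
      simp [ρ, h, this]
  omega
end

section
/- Reduction to the assignment problem for uniform equal-size marginals: if m = n and w i = v j = 1/n for all i, j, then there exists a permutation σ of Fin n such that the coupling π_σ defined by π_σ i j = 1/n if j = σ i and π_σ i j = 0 otherwise is optimal: C(π_σ) ≤ C(π) for every coupling π. In particular the optimal transport problem admits a Monge (deterministic) solution in this case. -/
open Finset

/-- Reduction to the assignment problem for uniform equal-size marginals:
there is a permutation `σ` whose induced coupling is optimal. -/
theorem stmt_13 (n : ℕ) (hn : 1 ≤ n) (c : Fin n → Fin n → ℝ) :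
    ∃ σ : Equiv.Perm (Fin n),
      ((∀ i j, 0 ≤ (if j = σ i then (1 / n : ℝ) else 0)) ∧
        (∀ i, ∑ j, (if j = σ i then (1 / n : ℝ) else 0) = 1 / n) ∧
        (∀ j, ∑ i, (if j = σ i then (1 / n : ℝ) else 0) = 1 / n)) ∧
      ∀ π : Fin n → Fin n → ℝ,
        (∀ i j, 0 ≤ π i j) → (∀ i, ∑ j, π i j = 1 / n) → (∀ j, ∑ i, π i j = 1 / n) →
        ∑ i, ∑ j, c i j * (if j = σ i then (1 / n : ℝ) else 0)
          ≤ ∑ i, ∑ j, c i j * π i j := by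
  have hn0 : (n : ℝ) ≠ 0 := by
    have : n ≠ 0 := by omega
    exact_mod_cast this
  have hnp : (0 : ℝ) ≤ 1 / n := by positivity
  obtain ⟨σ, hσ⟩ := Finite.exists_min (fun τ : Equiv.Perm (Fin n) => ∑ i, c i (τ i))
  refine ⟨σ, ⟨?_, ?_, ?_⟩, ?_⟩
  · intro i j
    split_ifs
    · exact hnp
    · exact le_rfl
  · intro i
    simp
  · intro j
    rw [Equiv.sum_comp σ (fun k => if j = k then (1 / n : ℝ) else 0)]
    simp
  · intro π h0 h1 h2
    have hM : (Matrix.of fun i j => (n : ℝ) * π i j) ∈ doublyStochastic ℝ (Fin n) := by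
      rw [mem_doublyStochastic_iff_sum]
      refine ⟨fun i j => ?_, fun i => ?_, fun j => ?_⟩
      · exact mul_nonneg (Nat.cast_nonneg n) (h0 i j)
      · simp only [Matrix.of_apply]
        rw [← Finset.mul_sum, h1]
        field_simp
      · simp only [Matrix.of_apply]
        rw [← Finset.mul_sum, h2]
        field_simp
    obtain ⟨w, hw0, hw1, hw⟩ := exists_eq_sum_perm_of_mem_doublyStochastic hM
    have hπ : ∀ i j, π i j = (1 / n : ℝ) * ∑ τ, w τ * (if j = τ i then 1 else 0) := by
      intro i j
      have h := congrFun (congrFun hw i) j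
      simp only [Matrix.sum_apply, Matrix.smul_apply, Matrix.of_apply, smul_eq_mul,
        Equiv.Perm.permMatrix, PEquiv.toMatrix_apply, Equiv.toPEquiv_apply,
        Option.mem_def, Option.some.injEq] at h
      simp only [eq_comm (a := j)]
      rw [h]
      field_simp
    have hL : ∑ i, ∑ j, c i j * (if j = σ i then (1 / n : ℝ) else 0)
        = (1 / n : ℝ) * ∑ i, c i (σ i) := by
      rw [Finset.mul_sum]
      refine Finset.sum_congr rfl fun i _ => ?_
      simp [mul_comm]
    have hR : ∑ i, ∑ j, c i j * π i j = (1 / n : ℝ) * ∑ τ, w τ * ∑ i, c i (τ i) := by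
      calc ∑ i, ∑ j, c i j * π i j
          = ∑ i, ∑ j, ∑ τ : Equiv.Perm (Fin n),
              (1 / n : ℝ) * (w τ * (c i j * (if j = τ i then 1 else 0))) := by
            refine Finset.sum_congr rfl fun i _ => Finset.sum_congr rfl fun j _ => ?_
            rw [hπ, Finset.mul_sum, Finset.mul_sum]
            refine Finset.sum_congr rfl fun τ _ => ?_
            ring
        _ = ∑ i, ∑ τ : Equiv.Perm (Fin n), (1 / n : ℝ) * (w τ * c i (τ i)) := by
            refine Finset.sum_congr rfl fun i _ => ?_
            rw [Finset.sum_comm]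
            refine Finset.sum_congr rfl fun τ _ => ?_
            rw [← Finset.mul_sum, ← Finset.mul_sum]
            simp
        _ = _ := by
            rw [Finset.sum_comm, Finset.mul_sum]
            refine Finset.sum_congr rfl fun τ _ => ?_
            rw [← Finset.mul_sum, ← Finset.mul_sum]
    rw [hL, hR]
    refine mul_le_mul_of_nonneg_left ?_ hnp
    calc ∑ i, c i (σ i) = ∑ τ, w τ * ∑ i, c i (σ i) := by
          rw [← Finset.sum_mul, hw1, one_mul]
      _ ≤ _ := Finset.sum_le_sum fun τ _ => mul_le_mul_of_nonneg_left (hσ τ) (hw0 τ)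
end
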